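/- For α ∈ [1,2) ∪ (3,4], the Horodecki state ρ^(3)_α = (1/7)(2 P⁺₃ + α Π₁ + (5−α) Π₂) on ℂ³ ⊗ ℂ³ has positive semidefinite partial transpose (it is PPT), and there exist a,b,c ≥ 0 with a ≤ 1, a+b+c = 2 and bc = (1−a)² such that Tr(ρ^(3)_α W[a,b,c]) < 0; in particular ρ^(3)_α is PPT entangled. -/

import Mathlib

open Complex Matrix ComplexOrder

/-- The operator `W[a,b,c]` on `ℂ³ ⊗ ℂ³`, identified with a `9 × 9` complex
matrix in the product basis `|i,j⟩`, indices mod 3. -/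
noncomputable def W3 (a b c : ℝ) :
    Matrix (Fin 3 × Fin 3) (Fin 3 × Fin 3) ℂ := fun p q =>
  if p = q then
    (if p.2 = p.1 then (a : ℂ)
     else if p.2 = p.1 + 1 then (b : ℂ)
     else (c : ℂ))
  else if p.1 = p.2 ∧ q.1 = q.2 then -1 else 0

/-- The product vector `ψ ⊗ φ`. -/
def prodVec {α β : Type*} (ψ : α → ℂ) (φ : β → ℂ) : α × β → ℂ :=
  fun p => ψ p.1 * φ p.2

/-- The pairing `⟨v| X |v⟩`. -/
noncomputable def pairing {n : Type*} [Fintype n] (X : Matrix n n ℂ) (v : n → ℂ) : ℂ :=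
  star v ⬝ᵥ X.mulVec v

/-- The (unnormalized-by-1/3) maximally entangled projection
`P⁺₃ = (1/3) Σ_{i,j} |i,i⟩⟨j,j|` on `ℂ³ ⊗ ℂ³`. -/
noncomputable def P3plus : Matrix (Fin 3 × Fin 3) (Fin 3 × Fin 3) ℂ := fun p q =>
  if p.1 = p.2 ∧ q.1 = q.2 then (1 / 3 : ℂ) else 0

/-- `Π_k = (1/3) Σ_l |l,l+k⟩⟨l,l+k|` on `ℂ³ ⊗ ℂ³`, index mod 3. -/
noncomputable def Pi3 (k : Fin 3) : Matrix (Fin 3 × Fin 3) (Fin 3 × Fin 3) ℂ := fun p q =>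
  if p = q ∧ p.2 = p.1 + k then (1 / 3 : ℂ) else 0

/-- The Horodecki state `ρ⁽³⁾_α = (1/7)(2P⁺₃ + αΠ₁ + (5-α)Π₂)`. -/
noncomputable def rho3 (α : ℝ) : Matrix (Fin 3 × Fin 3) (Fin 3 × Fin 3) ℂ :=
  (7 : ℂ)⁻¹ • ((2 : ℂ) • P3plus + (α : ℂ) • Pi3 1 + ((5 : ℂ) - (α : ℂ)) • Pi3 2)

/-- Partial transposition on the second tensor factor:
`⟨i,j| ρᴳ |k,l⟩ = ⟨i,l| ρ |k,j⟩`. -/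
def ptrans {α β : Type*} (Q : Matrix (α × β) (α × β) ℂ) : Matrix (α × β) (α × β) ℂ :=
  fun p q => Q (p.1, q.2) (q.1, p.2)

/-- The vector `s |l,l+1⟩ + t |l+1,l⟩` of `ℂ³ ⊗ ℂ³`, indices mod 3. -/
def cyclicPairVec (s t : ℂ) (l : Fin 3) : Fin 3 × Fin 3 → ℂ := fun p =>
  if p = (l, l + 1) then s else if p = (l + 1, l) then t else 0

/-- The partial transpose of `ρ⁽³⁾_α` as a combination of rank-one projections, with coefficients
that are nonnegative for `α ∈ [1,4]`. -/
lemma ptrans_rho3_eq (α : ℝ) :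
    ptrans (rho3 α) =
      (2 / 21 : ℝ) • ∑ i : Fin 3, vecMulVec (Pi.single (i, i) 1) (star (Pi.single (i, i) (1 : ℂ))) +
      ((4 - α) / 63) • ∑ l : Fin 3,
        vecMulVec (cyclicPairVec 1 2 l) (star (cyclicPairVec 1 2 l)) +
      ((α - 1) / 63) • ∑ l : Fin 3,
        vecMulVec (cyclicPairVec 2 1 l) (star (cyclicPairVec 2 1 l)) := by
  ext ⟨i, j⟩ ⟨k, l⟩
  fin_cases i <;> fin_cases j <;> fin_cases k <;> fin_cases l <;>
    simp [ptrans, rho3, P3plus, Pi3, Fin.sum_univ_three, vecMulVec_apply, cyclicPairVec] <;>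
    ring

lemma posSemidef_ptrans_rho3 {α : ℝ} (h₁ : 1 ≤ α) (h₄ : α ≤ 4) :
    (ptrans (rho3 α)).PosSemidef := by
  rw [ptrans_rho3_eq]
  refine ((PosSemidef.smul ?_ (by norm_num)).add (PosSemidef.smul ?_ (by linarith))).add
    (PosSemidef.smul ?_ (by linarith)) <;>
  exact posSemidef_sum _ fun _ _ => posSemidef_vecMulVec_self_star _

lemma trace_rho3_mul_W3 (α a b c : ℝ) :
    (rho3 α * W3 a b c).trace = ((2 * a + α * b + (5 - α) * c - 4) / 7 : ℝ) := by
  simp [Matrix.trace, Matrix.mul_apply, Fintype.sum_prod_type, Fin.sum_univ_three, rho3, P3plus,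
    Pi3, W3]
  ring

/-- for `α ∈ [1,2) ∪ (3,4]` the Horodecki state `ρ⁽³⁾_α` is PPT and
its entanglement is detected by some witness `W[a,b,c]` with `a ≤ 1`,
`a+b+c = 2`, `bc = (1-a)²`. -/
theorem rho3_PPT_entangled (α : ℝ)
    (hα : α ∈ Set.Ico (1 : ℝ) 2 ∪ Set.Ioc (3 : ℝ) 4) :
    (ptrans (rho3 α)).PosSemidef ∧
      ∃ a b c : ℝ, 0 ≤ a ∧ 0 ≤ b ∧ 0 ≤ c ∧ a ≤ 1 ∧ a + b + c = 2 ∧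
        b * c = (1 - a) ^ 2 ∧ (rho3 α * W3 a b c).trace < 0 := by
  rw [Set.mem_union, Set.mem_Ico, Set.mem_Ioc] at hα
  refine ⟨posSemidef_ptrans_rho3 ?_ ?_, ?_⟩
  · rcases hα with h | h <;> linarith
  · rcases hα with h | h <;> linarith
  · rcases hα with h | h
    · refine ⟨1, 1, 0, by norm_num, by norm_num, by norm_num, by norm_num, by norm_num,
        by norm_num, ?_⟩
      rw [trace_rho3_mul_W3, ← Complex.ofReal_zero, Complex.real_lt_real]
      linarith
    · refine ⟨1, 0, 1, by norm_num, by norm_num, by norm_num, by norm_num, by norm_num,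
        by norm_num, ?_⟩
      rw [trace_rho3_mul_W3, ← Complex.ofReal_zero, Complex.real_lt_real]
      linarith
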